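/- arXiv:2207.07500 — 7 statements merged into one kernel-verified Lean document; each statement's English description precedes it below -/
import Mathlib

section
/- For all fixed x, y ∈ [0,1], the Dombi t-norm converges to the minimum t-norm as the parameter tends to infinity: D_λ(x,y) → min(x,y) as λ → ∞. -/
/-- The Dombi t-norm with parameter `l`. -/
noncomputable def dombi (l x y : ℝ) : ℝ :=
  if x = 0 ∨ y = 0 then 0
  else (1 + (((1 - x) / x) ^ l + ((1 - y) / y) ^ l) ^ (1 / l))⁻¹

/-- The `ℓ^p` norm of a pair of nonnegative reals tends to its larger entry as `p → ∞`. -/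
theorem tendsto_rpow_add_rpow_of_le {a b : ℝ} (ha : 0 ≤ a) (hab : a ≤ b) :
    Filter.Tendsto (fun p : ℝ => (a ^ p + b ^ p) ^ (1 / p)) Filter.atTop (nhds b) := by
  have hb : 0 ≤ b := ha.trans hab
  have hupper : Filter.Tendsto (fun p : ℝ => (2 : ℝ) ^ (1 / p) * b) Filter.atTop (nhds b) := by
    have hexp : Filter.Tendsto (fun p : ℝ => 1 / p) Filter.atTop (nhds 0) := by
      simpa using tendsto_inv_atTop_zero (𝕜 := ℝ)
    simpa using (tendsto_const_nhds.rpow hexp (Or.inl (two_ne_zero (α := ℝ)))).mul_const b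
  refine tendsto_of_tendsto_of_tendsto_of_le_of_le' tendsto_const_nhds hupper ?_ ?_
  all_goals
    filter_upwards [Filter.eventually_gt_atTop (0 : ℝ)] with p hp
    have hap : 0 ≤ a ^ p := Real.rpow_nonneg ha p
    have hbp : 0 ≤ b ^ p := Real.rpow_nonneg hb p
    have hle : a ^ p ≤ b ^ p := Real.rpow_le_rpow ha hab hp.le
    have hroot : (b ^ p) ^ (1 / p) = b := by
      rw [one_div, Real.rpow_rpow_inv hb hp.ne']
  · calc b = (b ^ p) ^ (1 / p) := hroot.symm
      _ ≤ (a ^ p + b ^ p) ^ (1 / p) :=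
        Real.rpow_le_rpow hbp (by linarith) (by positivity)
  · calc (a ^ p + b ^ p) ^ (1 / p) ≤ (2 * b ^ p) ^ (1 / p) :=
          Real.rpow_le_rpow (by positivity) (by linarith) (by positivity)
      _ = 2 ^ (1 / p) * b := by rw [Real.mul_rpow two_pos.le hbp, hroot]

theorem dombi_comm (l x y : ℝ) : dombi l x y = dombi l y x := by
  simp only [dombi, or_comm, add_comm]

theorem dombi_tendsto_left_of_le {x y : ℝ} (hx : 0 ≤ x) (hxy : x ≤ y) (hy : y ≤ 1) :
    Filter.Tendsto (fun l : ℝ => dombi l x y) Filter.atTop (nhds x) := by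
  rcases hx.eq_or_lt with rfl | hx
  · simp [dombi]
  have hy0 : 0 < y := hx.trans_le hxy
  have hle : (1 - y) / y ≤ (1 - x) / x := by
    gcongr
    linarith
  have hlim := tendsto_rpow_add_rpow_of_le (div_nonneg (sub_nonneg.2 hy) hy0.le) hle
  have hx' : 1 + (1 - x) / x = x⁻¹ := by
    field_simp
    ring
  have hinv := (hlim.const_add 1).inv₀ (by rw [hx']; positivity)
  rw [hx', inv_inv] at hinv
  simp_rw [dombi_comm _ x y]
  simpa only [dombi, hx.ne', hy0.ne', or_self, if_false] using hinv

/-- As the parameter tends to infinity, the Dombi t-norm converges to the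
minimum t-norm. -/
theorem dombi_tendsto_min (x y : ℝ) (hx : x ∈ Set.Icc (0 : ℝ) 1)
    (hy : y ∈ Set.Icc (0 : ℝ) 1) :
    Filter.Tendsto (fun l : ℝ => dombi l x y) Filter.atTop (nhds (min x y)) := by
  rcases le_total x y with h | h
  · rw [min_eq_left h]
    exact dombi_tendsto_left_of_le hx.1 h hy.2
  · simp_rw [min_eq_right h, dombi_comm _ x y]
    exact dombi_tendsto_left_of_le hy.1 h hx.2
end

section
/- Let 0 < b ≤ a ≤ 1. Then V(b,a) ∈ (0,1] and D_λ(a, V(b,a)) = b; that is, V(b,a) solves the single equation D_λ(a,x) = b. -/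
/-- The solving operation `V(b, a)` associated with the Dombi t-norm. -/
noncomputable def V (l b a : ℝ) : ℝ :=
  (1 + (((1 - b) / b) ^ l - ((1 - a) / a) ^ l) ^ (1 / l))⁻¹

/-- For `0 < b ≤ a ≤ 1`, `V(b,a) ∈ (0,1]` and `V(b,a)` solves `D_λ(a, x) = b`. -/
theorem V_solves (l : ℝ) (hl : 0 < l) (a b : ℝ) (hb : 0 < b) (hba : b ≤ a)
    (ha : a ≤ 1) :
    V l b a ∈ Set.Ioc (0 : ℝ) 1 ∧ dombi l a (V l b a) = b := by
  have ha0 : 0 < a := hb.trans_le hba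
  have hq : 0 ≤ (1 - a) / a := div_nonneg (by linarith) ha0.le
  have hqp : (1 - a) / a ≤ (1 - b) / b := by
    rw [div_le_div_iff₀ ha0 hb]
    nlinarith
  have hp : 0 ≤ (1 - b) / b := hq.trans hqp
  have hd : 0 ≤ ((1 - b) / b) ^ l - ((1 - a) / a) ^ l :=
    sub_nonneg.mpr (Real.rpow_le_rpow hq hqp hl.le)
  have hu : 0 ≤ (((1 - b) / b) ^ l - ((1 - a) / a) ^ l) ^ (1 / l) :=
    Real.rpow_nonneg hd _
  have hV : 0 < V l b a := by
    unfold V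
    positivity
  refine ⟨⟨hV, inv_le_one_of_one_le₀ (by linarith)⟩, ?_⟩
  have hx : (1 - V l b a) / V l b a =
      (((1 - b) / b) ^ l - ((1 - a) / a) ^ l) ^ (1 / l) := by
    rw [sub_div, div_self hV.ne', one_div, V, inv_inv]
    ring
  rw [dombi, if_neg (by simp [ha0.ne', hV.ne']), hx, one_div, Real.rpow_inv_rpow hd hl.ne',
    add_sub_cancel, Real.rpow_rpow_inv hp hl.ne']
  field_simp
  ring
end

section
/- Let a ∈ [0,1] and b ∈ (0,1]. The equation D_λ(a,x) = b has a solution x ∈ [0,1] if and only if a ≥ b; moreover, when a ≥ b the solution is unique and equals V(b,a). -/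
theorem one_sub_div_nonneg {x : ℝ} (hx : x ∈ Set.Ioc (0 : ℝ) 1) : 0 ≤ (1 - x) / x :=
  div_nonneg (sub_nonneg.2 hx.2) hx.1.le

theorem inv_one_add_mem_Ioc {t : ℝ} (ht : 0 ≤ t) : (1 + t)⁻¹ ∈ Set.Ioc (0 : ℝ) 1 :=
  ⟨by positivity, inv_le_one_of_one_le₀ (by linarith)⟩

theorem inv_one_add_eq_iff {t b : ℝ} (hb : 0 < b) :
    (1 + t)⁻¹ = b ↔ t = (1 - b) / b := by
  rw [inv_eq_iff_eq_inv, sub_div, div_self hb.ne', one_div, eq_sub_iff_add_eq']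

theorem one_sub_div_le_iff {a b : ℝ} (ha : 0 < a) (hb : 0 < b) :
    (1 - a) / a ≤ (1 - b) / b ↔ b ≤ a := by
  rw [sub_div, sub_div, div_self ha.ne', div_self hb.ne', sub_le_sub_iff_right,
    one_div_le_one_div ha hb]

/-- For positive arguments, the Dombi equation is additive in the generator
`x ↦ ((1 - x) / x) ^ l`. -/
theorem dombi_eq_iff {l a x b : ℝ} (hl : 0 < l) (ha : a ∈ Set.Ioc (0 : ℝ) 1)
    (hx : x ∈ Set.Ioc (0 : ℝ) 1) (hb : b ∈ Set.Ioc (0 : ℝ) 1) :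
    dombi l a x = b ↔ ((1 - a) / a) ^ l + ((1 - x) / x) ^ l = ((1 - b) / b) ^ l := by
  have h : 0 ≤ ((1 - a) / a) ^ l + ((1 - x) / x) ^ l :=
    add_nonneg (Real.rpow_nonneg (one_sub_div_nonneg ha) l)
      (Real.rpow_nonneg (one_sub_div_nonneg hx) l)
  rw [dombi, if_neg (not_or.2 ⟨ha.1.ne', hx.1.ne'⟩),
    inv_one_add_eq_iff hb.1, one_div,
    Real.rpow_inv_eq h (one_sub_div_nonneg hb) hl.ne']

theorem eq_V_iff {l a b x : ℝ} (hl : 0 < l) (ha : a ∈ Set.Ioc (0 : ℝ) 1) (hb : 0 < b)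
    (hba : b ≤ a) (hx : x ∈ Set.Ioc (0 : ℝ) 1) :
    x = V l b a ↔ ((1 - a) / a) ^ l + ((1 - x) / x) ^ l = ((1 - b) / b) ^ l := by
  have h : 0 ≤ ((1 - b) / b) ^ l - ((1 - a) / a) ^ l :=
    sub_nonneg.2 (Real.rpow_le_rpow (one_sub_div_nonneg ha)
      ((one_sub_div_le_iff ha.1 hb).2 hba) hl.le)
  rw [eq_comm, V, inv_one_add_eq_iff hx.1, one_div,
    Real.rpow_inv_eq h (one_sub_div_nonneg hx) hl.ne', sub_eq_iff_eq_add', eq_comm]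

theorem V_mem_Ioc {l a b : ℝ} (hl : 0 < l) (ha : a ∈ Set.Ioc (0 : ℝ) 1) (hb : 0 < b)
    (hba : b ≤ a) : V l b a ∈ Set.Ioc (0 : ℝ) 1 :=
  inv_one_add_mem_Ioc (Real.rpow_nonneg (sub_nonneg.2
    (Real.rpow_le_rpow (one_sub_div_nonneg ha) ((one_sub_div_le_iff ha.1 hb).2 hba) hl.le)) _)

theorem pos_of_dombi_pos {l a x : ℝ} (ha : 0 ≤ a) (hx : 0 ≤ x) (h : 0 < dombi l a x) :
    0 < a ∧ 0 < x := by
  have h' : ¬(a = 0 ∨ x = 0) := fun h0 => by simp [dombi, h0] at h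
  rw [not_or] at h'
  exact ⟨ha.lt_of_ne' h'.1, hx.lt_of_ne' h'.2⟩

/-- For `a ∈ [0,1]` and `b ∈ (0,1]`, the equation `D_λ(a,x) = b` has a solution
`x ∈ [0,1]` iff `a ≥ b`; when `a ≥ b` the solution is unique and equals `V(b,a)`. -/
theorem dombi_eq_solvable_iff (l : ℝ) (hl : 0 < l) (a b : ℝ)
    (ha : a ∈ Set.Icc (0 : ℝ) 1) (hb : b ∈ Set.Ioc (0 : ℝ) 1) :
    ((∃ x ∈ Set.Icc (0 : ℝ) 1, dombi l a x = b) ↔ b ≤ a) ∧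
    (b ≤ a → V l b a ∈ Set.Icc (0 : ℝ) 1 ∧ dombi l a (V l b a) = b ∧
      ∀ x ∈ Set.Icc (0 : ℝ) 1, dombi l a x = b → x = V l b a) := by
  have forward : ∀ x ∈ Set.Icc (0 : ℝ) 1, dombi l a x = b →
      a ∈ Set.Ioc (0 : ℝ) 1 ∧ x ∈ Set.Ioc (0 : ℝ) 1 ∧
        ((1 - a) / a) ^ l + ((1 - x) / x) ^ l = ((1 - b) / b) ^ l := by
    intro x hx h
    obtain ⟨ha0, hx0⟩ := pos_of_dombi_pos ha.1 hx.1 (h ▸ hb.1)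
    exact ⟨⟨ha0, ha.2⟩, ⟨hx0, hx.2⟩, (dombi_eq_iff hl ⟨ha0, ha.2⟩ ⟨hx0, hx.2⟩ hb).1 h⟩
  have backward : b ≤ a → V l b a ∈ Set.Icc (0 : ℝ) 1 ∧ dombi l a (V l b a) = b := by
    intro hba
    have ha' : a ∈ Set.Ioc (0 : ℝ) 1 := ⟨hb.1.trans_le hba, ha.2⟩
    have hV := V_mem_Ioc hl ha' hb.1 hba
    exact ⟨Set.Ioc_subset_Icc_self hV,
      (dombi_eq_iff hl ha' hV hb).2 ((eq_V_iff hl ha' hb.1 hba hV).1 rfl)⟩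
  refine ⟨⟨?_, fun hba => ⟨V l b a, backward hba⟩⟩,
    fun hba => ⟨(backward hba).1, (backward hba).2, fun x hx h => ?_⟩⟩
  · rintro ⟨x, hx, h⟩
    obtain ⟨ha', hx', hsum⟩ := forward x hx h
    rw [← one_sub_div_le_iff ha'.1 hb.1,
      ← Real.rpow_le_rpow_iff (one_sub_div_nonneg ha') (one_sub_div_nonneg hb) hl, ← hsum]
    exact le_add_of_nonneg_right (Real.rpow_nonneg (one_sub_div_nonneg hx') l)
  · obtain ⟨ha', hx', hsum⟩ := forward x hx h
    exact (eq_V_iff hl ha' hb.1 hba hx').2 hsum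
end

section
/- Let 0 < b ≤ a ≤ 1 and x ∈ [0,1]. Then D_λ(a,x) ≤ b if and only if x ≤ V(b,a). -/
theorem inv_one_add_le_iff_odds_le {s y : ℝ} (hs : 0 ≤ s) (hy : 0 < y) :
    (1 + s)⁻¹ ≤ y ↔ (1 - y) / y ≤ s := by
  rw [inv_le_iff_one_le_mul₀ (by linarith), div_le_iff₀ hy]
  constructor <;> intro h <;> linarith

theorem le_inv_one_add_iff_le_odds {s y : ℝ} (hs : 0 ≤ s) (hy : 0 < y) :
    y ≤ (1 + s)⁻¹ ↔ s ≤ (1 - y) / y := by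
  rw [← one_div, le_div_iff₀ (by linarith), le_div_iff₀ hy]
  constructor <;> intro h <;> linarith

/-- For `0 < b ≤ a ≤ 1` and `x ∈ [0,1]`, `D_λ(a,x) ≤ b` iff `x ≤ V(b,a)`. -/
theorem dombi_le_iff (l : ℝ) (hl : 0 < l) (a b x : ℝ) (hb : 0 < b) (hba : b ≤ a)
    (ha : a ≤ 1) (hx : x ∈ Set.Icc (0 : ℝ) 1) :
    dombi l a x ≤ b ↔ x ≤ V l b a := by
  obtain ⟨hx0, hx1⟩ := hx
  have ha0 : 0 < a := hb.trans_le hba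
  have hv : 0 ≤ (1 - a) / a := div_nonneg (by linarith) ha0.le
  have hvu : (1 - a) / a ≤ (1 - b) / b := by
    rw [div_le_div_iff₀ ha0 hb]
    linarith
  have hu : 0 ≤ (1 - b) / b := hv.trans hvu
  have hd : 0 ≤ ((1 - b) / b) ^ l - ((1 - a) / a) ^ l :=
    sub_nonneg.2 (Real.rpow_le_rpow hv hvu hl.le)
  rcases hx0.eq_or_lt with rfl | hxpos
  · have hV : 0 ≤ V l b a := by
      unfold V
      positivity
    simp [dombi, hb.le, hV]
  · have hw : 0 ≤ (1 - x) / x := div_nonneg (by linarith) hxpos.le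
    rw [dombi, if_neg (by simp [ha0.ne', hxpos.ne']), V,
      inv_one_add_le_iff_odds_le (by positivity) hb,
      le_inv_one_add_iff_le_odds (by positivity) hxpos, one_div,
      Real.le_rpow_inv_iff_of_pos hu (by positivity) hl,
      Real.rpow_inv_le_iff_of_pos hd hw hl, sub_le_iff_le_add']
end

section
/- (Corollary 1) The feasible set S of the max-Dombi system is nonempty if and only if X̄ ∈ S; moreover, X̄ is the maximum solution: every x ∈ S satisfies x_j ≤ X̄_j for all j. -/
open scoped Classical

/-- The feasible set `S` of the max-Dombi system `A φ x = b` inside `[0,1]^n`. -/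
def feasible (l : ℝ) {m n : ℕ} (A : Fin (m + 1) → Fin (n + 1) → ℝ)
    (b : Fin (m + 1) → ℝ) : Set (Fin (n + 1) → ℝ) :=
  {x | (∀ j, x j ∈ Set.Icc (0 : ℝ) 1) ∧
    ∀ i, Finset.univ.sup' Finset.univ_nonempty (fun j => dombi l (A i j) (x j)) = b i}

/-- The vectors `x̂ᵢ` used to build the candidate maximum solution. -/
noncomputable def xhat (l : ℝ) {m n : ℕ} (A : Fin (m + 1) → Fin (n + 1) → ℝ)
    (b : Fin (m + 1) → ℝ) (i : Fin (m + 1)) (j : Fin (n + 1)) : ℝ :=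
  if 0 < b i ∧ b i ≤ A i j then V l (b i) (A i j)
  else if b i = 0 ∧ 0 < A i j then 0
  else 1

/-- The candidate maximum solution `X̄` of the max-Dombi system. -/
noncomputable def Xbar (l : ℝ) {m n : ℕ} (A : Fin (m + 1) → Fin (n + 1) → ℝ)
    (b : Fin (m + 1) → ℝ) (j : Fin (n + 1)) : ℝ :=
  Finset.univ.inf' Finset.univ_nonempty (fun i => xhat l A b i j)

theorem inv_one_add_one_sub_div {y : ℝ} (hy : y ≠ 0) : (1 + (1 - y) / y)⁻¹ = y := by
  field_simp
  ring

theorem one_sub_div_nonneg_s10 {y : ℝ} (hy : y ∈ Set.Icc (0 : ℝ) 1) : 0 ≤ (1 - y) / y :=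
  div_nonneg (sub_nonneg.2 hy.2) hy.1

theorem inv_one_add_mem_Icc {t : ℝ} (ht : 0 ≤ t) : (1 + t)⁻¹ ∈ Set.Icc (0 : ℝ) 1 :=
  ⟨by positivity, inv_le_one_of_one_le₀ (by linarith)⟩

theorem inv_one_add_le_inv_one_add {s t : ℝ} (hs : 0 ≤ s) (ht : 0 ≤ t) :
    (1 + s)⁻¹ ≤ (1 + t)⁻¹ ↔ t ≤ s := by
  rw [inv_le_inv₀ (by positivity) (by positivity), add_le_add_iff_left]

theorem dombi_mem_Icc {l a x : ℝ} (ha : a ∈ Set.Icc (0 : ℝ) 1) (hx : x ∈ Set.Icc (0 : ℝ) 1) :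
    dombi l a x ∈ Set.Icc (0 : ℝ) 1 := by
  unfold dombi
  split_ifs
  · simp
  · have hu := one_sub_div_nonneg_s10 ha
    have hv := one_sub_div_nonneg_s10 hx
    exact inv_one_add_mem_Icc (by positivity)

theorem dombi_pos {l a x : ℝ} (ha : a ∈ Set.Icc (0 : ℝ) 1) (hx : x ∈ Set.Icc (0 : ℝ) 1)
    (ha0 : a ≠ 0) (hx0 : x ≠ 0) : 0 < dombi l a x := by
  have hu := one_sub_div_nonneg_s10 ha
  have hv := one_sub_div_nonneg_s10 hx
  rw [dombi, if_neg (by tauto)]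
  positivity

theorem dombi_le_iff_rpow_le {l a b x : ℝ} (hl : 0 < l) (ha : a ∈ Set.Icc (0 : ℝ) 1)
    (hb : b ∈ Set.Icc (0 : ℝ) 1) (hx : x ∈ Set.Icc (0 : ℝ) 1)
    (ha0 : a ≠ 0) (hb0 : b ≠ 0) (hx0 : x ≠ 0) :
    dombi l a x ≤ b ↔ ((1 - b) / b) ^ l ≤ ((1 - a) / a) ^ l + ((1 - x) / x) ^ l := by
  have hu := one_sub_div_nonneg_s10 ha
  have hv := one_sub_div_nonneg_s10 hx
  have hw := one_sub_div_nonneg_s10 hb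
  rw [dombi, if_neg (by tauto)]
  conv_lhs => rw [← inv_one_add_one_sub_div hb0]
  rw [inv_one_add_le_inv_one_add (by positivity) hw, one_div,
    Real.le_rpow_inv_iff_of_pos hw (by positivity) hl]

theorem one_sub_div_le_one_sub_div {a b : ℝ} (hb : 0 < b) (hba : b ≤ a) :
    (1 - a) / a ≤ (1 - b) / b := by
  have ha : 0 < a := hb.trans_le hba
  rw [div_le_div_iff₀ ha hb]
  nlinarith

theorem rpow_one_sub_div_sub_nonneg {l a b : ℝ} (hl : 0 < l) (ha : a ∈ Set.Icc (0 : ℝ) 1)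
    (hb : 0 < b) (hba : b ≤ a) : 0 ≤ ((1 - b) / b) ^ l - ((1 - a) / a) ^ l :=
  sub_nonneg.2 (Real.rpow_le_rpow (one_sub_div_nonneg_s10 ha) (one_sub_div_le_one_sub_div hb hba) hl.le)

theorem V_mem_Icc {l a b : ℝ} (hl : 0 < l) (ha : a ∈ Set.Icc (0 : ℝ) 1) (hb : 0 < b)
    (hba : b ≤ a) : V l b a ∈ Set.Icc (0 : ℝ) 1 :=
  inv_one_add_mem_Icc (Real.rpow_nonneg (rpow_one_sub_div_sub_nonneg hl ha hb hba) _)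

theorem dombi_le_iff_le_V {l a b x : ℝ} (hl : 0 < l) (ha : a ∈ Set.Icc (0 : ℝ) 1)
    (hx : x ∈ Set.Icc (0 : ℝ) 1) (hb : 0 < b) (hba : b ≤ a) :
    dombi l a x ≤ b ↔ x ≤ V l b a := by
  rcases eq_or_ne x 0 with rfl | hx0
  · simpa [dombi, hb.le] using (V_mem_Icc hl ha hb hba).1
  · have h := rpow_one_sub_div_sub_nonneg hl ha hb hba
    have hv := one_sub_div_nonneg_s10 hx
    rw [dombi_le_iff_rpow_le hl ha ⟨hb.le, hba.trans ha.2⟩ hx (hb.trans_le hba).ne' hb.ne' hx0, V]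
    conv_rhs => rw [← inv_one_add_one_sub_div hx0]
    rw [inv_one_add_le_inv_one_add hv (Real.rpow_nonneg h _), one_div,
      Real.rpow_inv_le_iff_of_pos h hv hl, sub_le_iff_le_add']

/-- The residuum of the Dombi t-norm: the largest `x ∈ [0,1]` with `dombi l a x ≤ b`. -/
noncomputable def dombiResiduum (l b a : ℝ) : ℝ :=
  if 0 < b ∧ b ≤ a then V l b a else if b = 0 ∧ 0 < a then 0 else 1

theorem dombiResiduum_mem_Icc {l a b : ℝ} (hl : 0 < l) (ha : a ∈ Set.Icc (0 : ℝ) 1) :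
    dombiResiduum l b a ∈ Set.Icc (0 : ℝ) 1 := by
  unfold dombiResiduum
  split_ifs with h
  · exact V_mem_Icc hl ha h.1 h.2
  · simp
  · simp

theorem dombi_le_iff_le_dombiResiduum {l a b x : ℝ} (hl : 0 < l) (ha : a ∈ Set.Icc (0 : ℝ) 1)
    (hb : b ∈ Set.Icc (0 : ℝ) 1) (hx : x ∈ Set.Icc (0 : ℝ) 1) :
    dombi l a x ≤ b ↔ x ≤ dombiResiduum l b a := by
  unfold dombiResiduum
  split_ifs with h₁ h₂
  · exact dombi_le_iff_le_V hl ha hx h₁.1 h₁.2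
  · obtain ⟨rfl, ha0⟩ := h₂
    refine ⟨fun h => ?_, fun h => ?_⟩
    · by_contra! hx0
      exact h.not_gt (dombi_pos ha hx ha0.ne' hx0.ne')
    · simp [dombi, le_antisymm h hx.1]
  · refine iff_of_true ?_ hx.2
    by_cases h0 : a = 0 ∨ x = 0
    · simpa [dombi, h0] using hb.1
    · push Not at h0
      have ha0 : 0 < a := ha.1.lt_of_ne' h0.1
      have hb0 : 0 < b := hb.1.lt_of_ne' fun h => h₂ ⟨h, ha0⟩
      have hab : a ≤ b := le_of_not_ge fun h => h₁ ⟨hb0, h⟩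
      rw [dombi_le_iff_rpow_le hl ha hb hx h0.1 hb0.ne' h0.2]
      exact le_add_of_le_of_nonneg
        (Real.rpow_le_rpow (one_sub_div_nonneg_s10 hb) (one_sub_div_le_one_sub_div ha0 hab) hl.le)
        (Real.rpow_nonneg (one_sub_div_nonneg_s10 hx) _)

theorem dombi_le_dombi_right {l a x y : ℝ} (hl : 0 < l) (ha : a ∈ Set.Icc (0 : ℝ) 1)
    (hx : x ∈ Set.Icc (0 : ℝ) 1) (hy : y ∈ Set.Icc (0 : ℝ) 1) (hxy : x ≤ y) :
    dombi l a x ≤ dombi l a y := by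
  have hD := dombi_mem_Icc (l := l) ha hy
  exact (dombi_le_iff_le_dombiResiduum hl ha hD hx).2
    (hxy.trans ((dombi_le_iff_le_dombiResiduum hl ha hD hy).1 le_rfl))

/-- (Corollary 1) `S` is nonempty iff `X̄ ∈ S`; moreover `X̄` is the maximum solution. -/
theorem feasible_nonempty_iff_Xbar_mem (l : ℝ) (hl : 0 < l) {m n : ℕ}
    (A : Fin (m + 1) → Fin (n + 1) → ℝ) (b : Fin (m + 1) → ℝ)
    (hA : ∀ i j, A i j ∈ Set.Icc (0 : ℝ) 1) (hb : ∀ i, b i ∈ Set.Icc (0 : ℝ) 1) :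
    ((feasible l A b).Nonempty ↔ Xbar l A b ∈ feasible l A b) ∧
    (∀ x ∈ feasible l A b, ∀ j, x j ≤ Xbar l A b j) := by
  have hmax : ∀ x ∈ feasible l A b, ∀ j, x j ≤ Xbar l A b j := fun x hx j =>
    Finset.le_inf' _ _ fun i _ =>
      (dombi_le_iff_le_dombiResiduum hl (hA i j) (hb i) (hx.1 j)).1 <|
        (Finset.le_sup' (fun j => dombi l (A i j) (x j)) (Finset.mem_univ j)).trans_eq (hx.2 i)
  have hle : ∀ i j, Xbar l A b j ≤ dombiResiduum l (b i) (A i j) := fun i j =>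
    Finset.inf'_le (fun i => xhat l A b i j) (Finset.mem_univ i)
  have hX : ∀ j, Xbar l A b j ∈ Set.Icc (0 : ℝ) 1 := fun j =>
    ⟨Finset.le_inf' _ _ fun i _ => (dombiResiduum_mem_Icc hl (hA i j)).1,
      (hle 0 j).trans (dombiResiduum_mem_Icc hl (hA 0 j)).2⟩
  refine ⟨⟨?_, fun h => ⟨_, h⟩⟩, hmax⟩
  rintro ⟨x, hx⟩
  refine ⟨hX, fun i => le_antisymm ?_ ?_⟩
  · exact Finset.sup'_le _ _ fun j _ =>
      (dombi_le_iff_le_dombiResiduum hl (hA i j) (hb i) (hX j)).2 (hle i j)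
  · rw [← hx.2 i]
    exact Finset.sup'_mono_fun fun j _ =>
      dombi_le_dombi_right hl (hA i j) (hx.1 j) (hX j) (hmax x hx j)
end

section
/- Every feasible point of the max-Dombi system dominates a minimal solution: if x ∈ S, then there exists x̲ ∈ S such that x̲ ≤ x componentwise and x̲ is a minimal element of S with respect to the componentwise partial order (i.e., no y ∈ S satisfies y ≤ x̲ and y ≠ x̲). -/
open scoped Classical

/-- The Dombi t-norm is nonnegative on the unit square. -/
lemma dombi_nonneg {l a y : ℝ} (ha : a ∈ Set.Icc (0 : ℝ) 1) (hy : y ∈ Set.Icc (0 : ℝ) 1) :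
    0 ≤ dombi l a y := by
  unfold dombi
  split_ifs
  · exact le_rfl
  · have hu : 0 ≤ (1 - a) / a := div_nonneg (sub_nonneg.2 ha.2) ha.1
    have hv : 0 ≤ (1 - y) / y := div_nonneg (sub_nonneg.2 hy.2) hy.1
    positivity

/-- The Dombi t-norm is bounded above by its second argument. -/
lemma dombi_le_right {l a y : ℝ} (hl : 0 < l) (ha : a ∈ Set.Icc (0 : ℝ) 1)
    (hy : y ∈ Set.Icc (0 : ℝ) 1) : dombi l a y ≤ y := by
  unfold dombi
  split_ifs with h
  · exact hy.1
  · push Not at h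
    have hu : 0 ≤ (1 - a) / a := div_nonneg (sub_nonneg.2 ha.2) ha.1
    have hv : 0 ≤ (1 - y) / y := div_nonneg (sub_nonneg.2 hy.2) hy.1
    have hle : (1 - y) / y ≤ (((1 - a) / a) ^ l + ((1 - y) / y) ^ l) ^ (1 / l) := by
      calc (1 - y) / y = (((1 - y) / y) ^ l) ^ (1 / l) := by
            rw [one_div, Real.rpow_rpow_inv hv hl.ne']
        _ ≤ _ := Real.rpow_le_rpow (by positivity)
            (le_add_of_nonneg_left (by positivity)) (by positivity)
    have hinv : y = (1 + (1 - y) / y)⁻¹ := by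
      have := h.2
      field_simp
      ring
    calc _ ≤ (1 + (1 - y) / y)⁻¹ := inv_anti₀ (by positivity) (by linarith)
      _ = y := hinv.symm

/-- The Dombi t-norm is continuous in its second argument on the unit interval. -/
lemma continuousOn_dombi {l a : ℝ} (hl : 0 < l) (ha : a ∈ Set.Icc (0 : ℝ) 1) :
    ContinuousOn (dombi l a) (Set.Icc 0 1) := by
  rcases eq_or_ne a 0 with rfl | ha0
  · have : dombi l 0 = fun _ => 0 := by ext y; simp [dombi]
    rw [this]
    exact continuousOn_const
  intro y hy
  rcases eq_or_ne y 0 with rfl | hy0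
  · have h0 : dombi l a 0 = 0 := by simp [dombi]
    rw [ContinuousWithinAt, h0]
    refine tendsto_of_tendsto_of_tendsto_of_le_of_le' tendsto_const_nhds
      (continuousWithinAt_id (s := Set.Icc (0 : ℝ) 1) (x := 0)) ?_ ?_
    · filter_upwards [self_mem_nhdsWithin] with z hz using dombi_nonneg ha hz
    · filter_upwards [self_mem_nhdsWithin] with z hz using dombi_le_right hl ha hz
  · apply ContinuousAt.continuousWithinAt
    have heq : dombi l a =ᶠ[nhds y]
        fun z => (1 + (((1 - a) / a) ^ l + ((1 - z) / z) ^ l) ^ (1 / l))⁻¹ := by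
      filter_upwards [eventually_ne_nhds hy0] with z hz
      simp [dombi, ha0, hz]
    rw [continuousAt_congr heq]
    have hu : 0 ≤ (1 - a) / a := div_nonneg (sub_nonneg.2 ha.2) ha.1
    have hv : 0 ≤ (1 - y) / y := div_nonneg (sub_nonneg.2 hy.2) hy.1
    have hdiv : ContinuousAt (fun z : ℝ => (1 - z) / z) y :=
      (continuousAt_const.sub continuousAt_id).div continuousAt_id hy0
    refine ContinuousAt.inv₀ (continuousAt_const.add ?_) (by positivity)
    exact (continuousAt_const.add (hdiv.rpow_const (Or.inr hl.le))).rpow_const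
      (Or.inr (by positivity))

/-- The feasible set of the max-Dombi system is compact. -/
lemma isCompact_feasible {l : ℝ} (hl : 0 < l) {m n : ℕ}
    {A : Fin (m + 1) → Fin (n + 1) → ℝ} (b : Fin (m + 1) → ℝ)
    (hA : ∀ i j, A i j ∈ Set.Icc (0 : ℝ) 1) : IsCompact (feasible l A b) := by
  have hbox : IsCompact (Set.univ.pi fun _ : Fin (n + 1) => Set.Icc (0 : ℝ) 1) :=
    isCompact_univ_pi fun _ => isCompact_Icc
  have hcont : ContinuousOn
      (fun (x : Fin (n + 1) → ℝ) i =>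
        Finset.univ.sup' Finset.univ_nonempty (fun j => dombi l (A i j) (x j)))
      (Set.univ.pi fun _ => Set.Icc (0 : ℝ) 1) :=
    continuousOn_pi.2 fun i => ContinuousOn.finset_sup'_apply _ fun j _ =>
      (continuousOn_dombi hl (hA i j)).comp (continuous_apply j).continuousOn
        fun x hx => hx j trivial
  convert hbox.of_isClosed_subset
    (hcont.preimage_isClosed_of_isClosed hbox.isClosed (isClosed_singleton (x := b)))
    Set.inter_subset_left using 1
  ext x
  simp only [feasible, Set.mem_ofPred_eq, Set.mem_inter_iff, Set.mem_univ_pi, Set.mem_preimage,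
    Set.mem_singleton_iff, funext_iff]

/-- Every feasible point dominates a minimal solution of the max-Dombi system. -/
theorem exists_minimal_le (l : ℝ) (hl : 0 < l) {m n : ℕ}
    (A : Fin (m + 1) → Fin (n + 1) → ℝ) (b : Fin (m + 1) → ℝ)
    (hA : ∀ i j, A i j ∈ Set.Icc (0 : ℝ) 1) (hb : ∀ i, b i ∈ Set.Icc (0 : ℝ) 1)
    (x : Fin (n + 1) → ℝ) (hx : x ∈ feasible l A b) :
    ∃ y ∈ feasible l A b, (∀ j, y j ≤ x j) ∧
      ∀ z ∈ feasible l A b, (∀ j, z j ≤ y j) → z = y := by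
  have hK : IsCompact (feasible l A b ∩ Set.Iic x) :=
    (isCompact_feasible hl b hA).inter_right isClosed_Iic
  obtain ⟨y, ⟨hyS, hyx⟩, hmin⟩ := hK.exists_isMinOn ⟨x, hx, Set.self_mem_Iic⟩
    (f := fun z => ∑ j, z j) (by fun_prop)
  refine ⟨y, hyS, hyx, fun z hzS hzy => ?_⟩
  have hle : ∑ j, y j ≤ ∑ j, z j := hmin ⟨hzS, fun j => (hzy j).trans (hyx j)⟩
  have heq := (Finset.sum_eq_sum_iff_of_le fun j _ => hzy j).1
    ((Finset.sum_le_sum fun j _ => hzy j).antisymm hle)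
  exact funext fun j => heq j (Finset.mem_univ j)
end

section
/- (Theorem 1, step (I)) If a_{i₀j₀} < b_{i₀} for some indices i₀, j₀, and A' is the matrix obtained from A by replacing the single entry a_{i₀j₀} by 0, then the max-Dombi systems defined by A and by A' (with the same right-hand side b) have the same solution set. -/
open scoped Classical

theorem dombi_zero_left (l x : ℝ) : dombi l 0 x = 0 := by
  simp [dombi]

theorem dombi_le_left {l a x : ℝ} (hl : 0 < l) (ha : a ∈ Set.Icc (0 : ℝ) 1)
    (hx : x ∈ Set.Icc (0 : ℝ) 1) : dombi l a x ≤ a := by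
  unfold dombi
  split_ifs with h
  · exact ha.1
  · push Not at h
    have ha0 : 0 < a := lt_of_le_of_ne ha.1 h.1.symm
    have hu : 0 ≤ (1 - a) / a := div_nonneg (sub_nonneg.2 ha.2) ha.1
    have hv : 0 ≤ (1 - x) / x := div_nonneg (sub_nonneg.2 hx.2) hx.1
    have key : (1 - a) / a ≤ (((1 - a) / a) ^ l + ((1 - x) / x) ^ l) ^ (1 / l) := by
      calc (1 - a) / a = (((1 - a) / a) ^ l) ^ (1 / l) := by
            rw [one_div, Real.rpow_rpow_inv hu hl.ne']
        _ ≤ _ := Real.rpow_le_rpow (Real.rpow_nonneg hu l)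
            (le_add_of_nonneg_right (Real.rpow_nonneg hv l)) (one_div_nonneg.2 hl.le)
    refine inv_le_of_inv_le₀ ha0 ?_
    calc a⁻¹ = 1 + (1 - a) / a := by field_simp; ring
      _ ≤ _ := by gcongr

theorem Finset.sup'_eq_iff_forall_le_and_exists_eq {ι α : Type*} [LinearOrder α] {s : Finset ι}
    (hs : s.Nonempty) {f : ι → α} {c : α} :
    s.sup' hs f = c ↔ (∀ j ∈ s, f j ≤ c) ∧ ∃ j ∈ s, f j = c := by
  constructor
  · rintro rfl
    obtain ⟨j, hj, hjs⟩ := s.exists_mem_eq_sup' hs f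
    exact ⟨fun j hj => Finset.le_sup' f hj, j, hj, hjs.symm⟩
  · rintro ⟨hle, j, hj, rfl⟩
    exact le_antisymm (Finset.sup'_le hs f hle) (Finset.le_sup' f hj)

/-- A maximum equals `c` irrespective of the value at an index where that value is below `c`. -/
theorem Finset.sup'_eq_iff_of_eq_off {ι α : Type*} [LinearOrder α] {s : Finset ι}
    (hs : s.Nonempty) {f g : ι → α} {c : α} (h : ∀ j ∈ s, f j = g j ∨ f j < c ∧ g j < c) :
    s.sup' hs f = c ↔ s.sup' hs g = c := by
  simp only [Finset.sup'_eq_iff_forall_le_and_exists_eq]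
  refine and_congr (forall₂_congr fun j hj => ?_)
    (exists_congr fun j => and_congr_right fun hj => ?_)
  · rcases h j hj with h | ⟨hf, hg⟩
    · rw [h]
    · exact iff_of_true hf.le hg.le
  · rcases h j hj with h | ⟨hf, hg⟩
    · rw [h]
    · exact iff_of_false hf.ne hg.ne

/-- (Theorem 1, step (I)) Replacing a single entry `a_{i₀j₀} < b_{i₀}` of `A` by `0`
does not change the solution set of the max-Dombi system. -/
theorem feasible_eq_of_zero_entry (l : ℝ) (hl : 0 < l) {m n : ℕ}
    (A : Fin (m + 1) → Fin (n + 1) → ℝ) (b : Fin (m + 1) → ℝ)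
    (hA : ∀ i j, A i j ∈ Set.Icc (0 : ℝ) 1) (hb : ∀ i, b i ∈ Set.Icc (0 : ℝ) 1)
    (i₀ : Fin (m + 1)) (j₀ : Fin (n + 1)) (h : A i₀ j₀ < b i₀) :
    feasible l A b =
      feasible l (fun i j => if i = i₀ ∧ j = j₀ then 0 else A i j) b := by
  ext x
  refine and_congr_right fun hx => forall_congr' fun i => ?_
  refine Finset.sup'_eq_iff_of_eq_off _ fun j _ => ?_
  by_cases hij : i = i₀ ∧ j = j₀
  · obtain ⟨rfl, rfl⟩ := hij
    right
    refine ⟨(dombi_le_left hl (hA i j) (hx j)).trans_lt h, ?_⟩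
    simpa [dombi_zero_left] using (hA i j).1.trans_lt h
  · left
    simp [hij]
end
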